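/- Let f, g : G → H be quadratic maps between groups and let X be a generating subset of G. If f(x) = g(x) for all x ∈ X and d_f(x,y) = d_g(x,y) for all x, y ∈ X, then f = g. -/

import Mathlib

section QuadDefs

variable {G : Type*} {H : Type*} [Group G] [Group H]

/-- The deviation (cross effect) of a map between groups:
`dev f a b = f (a*b) * (f b)⁻¹ * (f a)⁻¹`. -/
def dev (f : G → H) (a b : G) : H := f (a * b) * (f b)⁻¹ * (f a)⁻¹

/-- A map between groups is quadratic if its deviation is bilinear and all of its
values commute with all values of `f`. -/
def IsQuadratic (f : G → H) : Prop :=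
  (∀ a a' b : G, dev f (a * a') b = dev f a b * dev f a' b) ∧
  (∀ a b b' : G, dev f a (b * b') = dev f a b * dev f a b') ∧
  (∀ a b c : G, Commute (dev f a b) (f c))

/-- A map between groups is quadratic relative a subgroup `B` if it is quadratic and
its deviation vanishes as soon as one argument is in `B`. -/
def IsQuadraticRel (f : G → H) (B : Subgroup G) : Prop :=
  IsQuadratic f ∧ ∀ a b : G, (a ∈ B ∨ b ∈ B) → dev f a b = 1

end QuadDefs

theorem map_mul_eq_dev_mul {G H : Type*} [Group G] [Group H] (f : G → H) (a b : G) :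
    f (a * b) = dev f a b * f a * f b := by
  simp [dev, mul_assoc]

theorem IsQuadratic.map_one {G H : Type*} [Group G] [Group H] {f : G → H}
    (hf : IsQuadratic f) : f 1 = 1 := by
  have h := hf.1 1 1 1
  simpa [dev] using h

/-- The deviation of a quadratic map as a homomorphism in its first argument. -/
def IsQuadratic.devLeft {G H : Type*} [Group G] [Group H] {f : G → H}
    (hf : IsQuadratic f) (b : G) : G →* H :=
  MonoidHom.mk' (fun a => dev f a b) fun a a' => hf.1 a a' b

/-- The deviation of a quadratic map as a homomorphism in its second argument. -/
def IsQuadratic.devRight {G H : Type*} [Group G] [Group H] {f : G → H}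
    (hf : IsQuadratic f) (a : G) : G →* H :=
  MonoidHom.mk' (fun b => dev f a b) fun b b' => hf.2.1 a b b'

/-- Deviations of quadratic maps are determined by their values on a generating set. -/
theorem IsQuadratic.dev_eq_of_closure_eq_top {G H : Type*} [Group G] [Group H] {f g : G → H}
    (hf : IsQuadratic f) (hg : IsQuadratic g) {X : Set G} (hX : Subgroup.closure X = ⊤)
    (h : ∀ x ∈ X, ∀ y ∈ X, dev f x y = dev g x y) (a b : G) : dev f a b = dev g a b := by
  have left (y : G) (hy : y ∈ X) : hf.devLeft y = hg.devLeft y :=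
    MonoidHom.eq_of_eqOn_dense hX fun x hx => h x hx y hy
  have right : hf.devRight a = hg.devRight a :=
    MonoidHom.eq_of_eqOn_dense hX fun y hy => DFunLike.congr_fun (left y hy) a
  exact DFunLike.congr_fun right b

theorem stmt11 {G H : Type*} [Group G] [Group H] (f g : G → H)
    (hf : IsQuadratic f) (hg : IsQuadratic g) (X : Set G)
    (hX : Subgroup.closure X = ⊤)
    (h1 : ∀ x ∈ X, f x = g x)
    (h2 : ∀ x ∈ X, ∀ y ∈ X, dev f x y = dev g x y) :
    f = g := by
  have hdev := hf.dev_eq_of_closure_eq_top hg hX h2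
  funext a
  have ha : a ∈ Subgroup.closure X := hX ▸ Subgroup.mem_top a
  induction ha using Subgroup.closure_induction with
  | mem x hx => exact h1 x hx
  | one => rw [hf.map_one, hg.map_one]
  | mul a b _ _ iha ihb => rw [map_mul_eq_dev_mul f, map_mul_eq_dev_mul g, hdev, iha, ihb]
  | inv a _ iha =>
    have h : f (a * a⁻¹) = g (a * a⁻¹) := by
      rw [mul_inv_cancel, hf.map_one, hg.map_one]
    rw [map_mul_eq_dev_mul f, map_mul_eq_dev_mul g, hdev, iha] at h
    exact mul_left_cancel h
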